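/- Let X be a complex Hilbert space, T ∈ B(X) with M = sup_{n≥0}‖Tⁿ‖ < ∞, n a positive integer, and suppose B := sup{‖(I−T)ⁿ R(λ,T)‖ : |λ| > 1} < ∞. Then for every m ≥ 0, ‖T^m (I−T)ⁿ‖ ≤ 2M²B/(m+2). -/

import Mathlib

open Finset in
/-- Discrete Parseval identity. -/
theorem aux_parseval {X : Type*} [NormedAddCommGroup X] [InnerProductSpace ℂ X]
    (N : ℕ) (hN : N ≠ 0) (ω : ℂ) (hω : IsPrimitiveRoot ω N) (s : Finset ℕ)
    (hs : ∀ k ∈ s, k < N) (a : ℕ → X) :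
    ∑ j ∈ range N, ‖∑ k ∈ s, ((ω ^ j) ^ k) • a k‖ ^ 2 = N * ∑ k ∈ s, ‖a k‖ ^ 2 := by
  have hnorm : ‖ω‖ = 1 := hω.norm'_eq_one hN
  have horth : ∀ k ∈ s, ∀ l ∈ s,
      ∑ j ∈ range N, (starRingEnd ℂ ((ω ^ j) ^ k)) * (ω ^ j) ^ l = if k = l then (N : ℂ) else 0 := by
    intro k hk l hl
    have hconj : ∀ i : ℕ, (starRingEnd ℂ (ω ^ i)) * ω ^ i = 1 := by
      intro i
      rw [← Complex.normSq_eq_conj_mul_self, Complex.normSq_eq_norm_sq]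
      simp [hnorm]
    have h1 : ∀ j, (starRingEnd ℂ ((ω ^ j) ^ k)) * (ω ^ j) ^ l
        = ((starRingEnd ℂ (ω ^ k)) * ω ^ l) ^ j := by
      intro j
      rw [mul_pow, ← map_pow, ← pow_mul, ← pow_mul, ← pow_mul, ← pow_mul, mul_comm j k, mul_comm j l]
    simp_rw [h1]
    split_ifs with hkl
    · subst hkl
      rw [hconj]; simp
    · have hne : (starRingEnd ℂ (ω ^ k)) * ω ^ l ≠ 1 := by
        intro h
        apply hkl
        apply hω.pow_inj (hs k hk) (hs l hl)
        calc ω ^ k = ω ^ k * ((starRingEnd ℂ (ω ^ k)) * ω ^ l) := by rw [h, mul_one]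
          _ = ((starRingEnd ℂ (ω ^ k)) * ω ^ k) * ω ^ l := by ring
          _ = ω ^ l := by rw [hconj, one_mul]
      rw [geom_sum_eq hne, mul_pow, ← map_pow, ← pow_mul, ← pow_mul, mul_comm k, mul_comm l,
        pow_mul, pow_mul, hω.pow_eq_one]
      simp
  have hC : ((∑ j ∈ range N, ‖∑ k ∈ s, ((ω ^ j) ^ k) • a k‖ ^ 2 : ℝ) : ℂ)
      = ((N * ∑ k ∈ s, ‖a k‖ ^ 2 : ℝ) : ℂ) := by
    push_cast
    have h2 : ∀ x : X, ((‖x‖ : ℂ)) ^ 2 = inner ℂ x x := fun x =>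
      (inner_self_eq_norm_sq_to_K (𝕜 := ℂ) x).symm
    simp_rw [h2, sum_inner, inner_sum, inner_smul_left, inner_smul_right]
    rw [sum_comm, mul_sum]
    refine sum_congr rfl fun k hk => ?_
    rw [sum_comm]
    have h3 : ∀ l ∈ s, ∑ j ∈ range N, (starRingEnd ℂ ((ω ^ j) ^ k)) *
        ((ω ^ j) ^ l * inner ℂ (a k) (a l)) = if k = l then (N : ℂ) * inner ℂ (a k) (a l) else 0 := by
      intro l hl
      simp_rw [← mul_assoc]
      rw [← sum_mul, horth k hk l hl]
      split_ifs <;> simp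
    rw [sum_congr rfl h3]
    simp [hk]
  exact_mod_cast hC

theorem aux_resolvent {X : Type*} [NormedAddCommGroup X] [InnerProductSpace ℂ X] [CompleteSpace X]
    (T : X →L[ℂ] X) (M : ℝ) (hM : ∀ m : ℕ, ‖T ^ m‖ ≤ M) (μ : ℂ) (hμ : 1 < ‖μ‖) :
    IsUnit (algebraMap ℂ (X →L[ℂ] X) μ - T) := by
  by_contra h
  have hmem : μ ∈ spectrum ℂ T := h
  obtain ⟨k, hk⟩ := pow_unbounded_of_one_lt M hμ
  have h1 := spectrum.norm_le_norm_mul_of_mem (spectrum.pow_mem_pow T k hmem)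
  have h2 : ‖(1 : X →L[ℂ] X)‖ ≤ 1 := ContinuousLinearMap.norm_id_le
  have h3 : ‖T ^ k‖ * ‖(1 : X →L[ℂ] X)‖ ≤ ‖T ^ k‖ := mul_le_of_le_one_right (norm_nonneg _) h2
  rw [norm_pow] at h1
  linarith [hM k]

theorem aux_bound {X : Type*} [NormedAddCommGroup X] [InnerProductSpace ℂ X] [CompleteSpace X]
    (T A : X →L[ℂ] X) (M : ℝ) (hM : ∀ m : ℕ, ‖T ^ m‖ ≤ M) (B : ℝ)
    (hB : ∀ lambda : ℂ, 1 < ‖lambda‖ → ‖A * resolvent T lambda‖ ≤ B)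
    (r : ℝ) (hr : 1 < r) (z : ℂ) (hz : ‖z‖ = 1) (y : X) :
    ‖A y‖ ≤ r * B * ‖y - (z * (r : ℂ)⁻¹) • T y‖ := by
  have hz0 : z ≠ 0 := by rintro rfl; simp at hz
  have hr0 : (r : ℂ) ≠ 0 := by exact_mod_cast (by linarith : r ≠ 0)
  have hnr : ‖(r : ℂ)‖ = r := by simp; linarith
  have hnm : ‖(r : ℂ) * z⁻¹‖ = r := by rw [norm_mul, norm_inv, hz, hnr]; simp
  have hm : 1 < ‖(r : ℂ) * z⁻¹‖ := by rw [hnm]; exact hr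
  have hu := aux_resolvent T M hM _ hm
  have h1 : A * resolvent T ((r : ℂ) * z⁻¹) * (algebraMap ℂ (X →L[ℂ] X) ((r : ℂ) * z⁻¹) - T) = A := by
    rw [mul_assoc, resolvent, Ring.inverse_mul_cancel _ hu, mul_one]
  have h2 : (algebraMap ℂ (X →L[ℂ] X) ((r : ℂ) * z⁻¹) - T) y
      = ((r : ℂ) * z⁻¹) • (y - (z * (r : ℂ)⁻¹) • T y) := by
    rw [smul_sub, smul_smul]
    have : (r : ℂ) * z⁻¹ * (z * (r : ℂ)⁻¹) = 1 := by field_simp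
    rw [this, one_smul, Algebra.algebraMap_eq_smul_one]
    simp
  calc ‖A y‖ = ‖(A * resolvent T ((r : ℂ) * z⁻¹)) ((algebraMap ℂ (X →L[ℂ] X) ((r : ℂ) * z⁻¹) - T) y)‖ := by
        conv_lhs => rw [← h1]
        rfl
    _ ≤ ‖A * resolvent T ((r : ℂ) * z⁻¹)‖ * ‖(algebraMap ℂ (X →L[ℂ] X) ((r : ℂ) * z⁻¹) - T) y‖ :=
        ContinuousLinearMap.le_opNorm _ _
    _ ≤ B * ‖(algebraMap ℂ (X →L[ℂ] X) ((r : ℂ) * z⁻¹) - T) y‖ := by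
        gcongr; exact hB _ hm
    _ = _ := by rw [h2, norm_smul, hnm]; ring

open Finset in
theorem aux_abel {X : Type*} [AddCommGroup X] [Module ℂ X] (v : ℕ → X) (m L : ℕ) :
    ∑ k ∈ range (m + 1 + L), ((min k m + 1 : ℕ) : ℂ) • v k
      - ∑ k ∈ range (m + 1 + L), ((min k m + 1 : ℕ) : ℂ) • v (k + 1)
      = ∑ k ∈ range (m + 1), v k - ((m + 1 : ℕ) : ℂ) • v (m + 1 + L) := by
  have base : ∀ p : ℕ, ∑ k ∈ range p, ((k + 1 : ℕ) : ℂ) • v k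
      - ∑ k ∈ range p, ((k + 1 : ℕ) : ℂ) • v (k + 1) = ∑ k ∈ range p, v k - (p : ℂ) • v p := by
    intro p
    induction p with
    | zero => simp
    | succ p ih =>
      rw [sum_range_succ, sum_range_succ, sum_range_succ, add_sub_add_comm, ih]
      push_cast
      module
  induction L with
  | zero =>
    rw [add_zero, ← base (m + 1)]
    congr 1 <;>
    · refine sum_congr rfl fun k hk => ?_
      rw [min_eq_left (by simp at hk; omega)]
  | succ L ih =>
    rw [← add_assoc, sum_range_succ, sum_range_succ, add_sub_add_comm, ih,
      min_eq_right (by omega)]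
    module

open Finset in
theorem aux_sum {X : Type*} [NormedAddCommGroup X] [InnerProductSpace ℂ X] [CompleteSpace X]
    (T A : X →L[ℂ] X) (hcomm : Commute A T) (M : ℝ) (hM : ∀ m : ℕ, ‖T ^ m‖ ≤ M) (B : ℝ)
    (hB : ∀ lambda : ℂ, 1 < ‖lambda‖ → ‖A * resolvent T lambda‖ ≤ B)
    (r : ℝ) (hr : 1 < r) (x : X) (m L : ℕ) :
    ∑ k ∈ range (m + 1), ((k + 1 : ℝ) * ((r⁻¹) ^ k * ‖(T ^ k * A) x‖)) ^ 2
      ≤ (r * B) ^ 2 * (((m + 1 : ℝ)) * (M * ‖x‖) ^ 2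
        + ((m + 1 : ℝ) * ((r⁻¹) ^ (m + 1 + L) * (M * ‖x‖))) ^ 2) := by
  have hr0 : 0 < r := by linarith
  have hM0 : 0 ≤ M := (norm_nonneg _).trans (hM 0)
  have hri : r⁻¹ ≤ 1 := inv_le_one_of_one_le₀ hr.le
  set q : ℂ := (r : ℂ)⁻¹ with hq
  have hnq : ‖q‖ = r⁻¹ := by rw [hq, norm_inv]; simp [abs_of_pos hr0]
  set w : ℕ → X := fun k => q ^ k • (T ^ k) x with hw
  set N := m + 1 + L + 1 with hN
  set c : ℕ → ℂ := fun k => ((min k m + 1 : ℕ) : ℂ) with hc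
  have hN0 : N ≠ 0 := by omega
  have hω := Complex.isPrimitiveRoot_exp N hN0
  set ω := Complex.exp (2 * Real.pi * Complex.I / N) with hωdef
  have hnorm : ‖ω‖ = 1 := hω.norm'_eq_one hN0
  set b : ℕ → X := fun k => if k ≤ m then w k else -(((m + 1 : ℕ) : ℂ) • w k) with hb
  have hnot : (m + 1 + L) ∉ range (m + 1) := by simp; omega
  have P1 := aux_parseval N hN0 ω hω (range (m + 1 + L)) (by simp [hN]; omega)
    (fun k => c k • A (w k))
  have P2 := aux_parseval N hN0 ω hω (insert (m + 1 + L) (range (m + 1)))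
    (by simp [hN]; omega) b
  have hbsum : ∀ z : ℂ, ∑ k ∈ insert (m + 1 + L) (range (m + 1)), z ^ k • b k
      = ∑ k ∈ range (m + 1), z ^ k • w k
        - ((m + 1 : ℕ) : ℂ) • (z ^ (m + 1 + L) • w (m + 1 + L)) := by
    intro z
    rw [sum_insert hnot]
    have : ∑ k ∈ range (m + 1), z ^ k • b k = ∑ k ∈ range (m + 1), z ^ k • w k := by
      refine sum_congr rfl fun k hk => ?_
      have : k ≤ m := by simp at hk; omega
      simp [hb, this]
    rw [this]
    have h5 : ¬ (m + 1 + L ≤ m) := by omega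
    simp only [hb, h5, if_false]
    module
  have hterm : ∀ z : ℂ, ‖z‖ = 1 → ‖∑ k ∈ range (m + 1 + L), z ^ k • (c k • A (w k))‖ ^ 2
      ≤ (r * B) ^ 2 * ‖∑ k ∈ insert (m + 1 + L) (range (m + 1)), z ^ k • b k‖ ^ 2 := by
    intro z hz
    have h := aux_bound T A M hM B hB r hr z hz (∑ k ∈ range (m + 1 + L), c k • (z ^ k • w k))
    have e1 : A (∑ k ∈ range (m + 1 + L), c k • (z ^ k • w k))
        = ∑ k ∈ range (m + 1 + L), z ^ k • (c k • A (w k)) := by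
      rw [map_sum]
      refine sum_congr rfl fun k _ => ?_
      rw [map_smul, map_smul, smul_comm]
    have e2 : (z * (r : ℂ)⁻¹) • T (∑ k ∈ range (m + 1 + L), c k • (z ^ k • w k))
        = ∑ k ∈ range (m + 1 + L), c k • (z ^ (k + 1) • w (k + 1)) := by
      rw [map_sum, smul_sum]
      refine sum_congr rfl fun k _ => ?_
      simp only [hw, map_smul, smul_smul]
      rw [pow_succ' T k, ContinuousLinearMap.mul_apply, ← hq]
      congr 1
      ring
    rw [e1, e2, aux_abel (fun k => z ^ k • w k), ← hbsum] at h
    rw [← mul_pow]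
    exact pow_le_pow_left₀ (norm_nonneg _) h 2
  have hmain : ∑ k ∈ range (m + 1 + L), ‖c k • A (w k)‖ ^ 2
      ≤ (r * B) ^ 2 * ∑ k ∈ insert (m + 1 + L) (range (m + 1)), ‖b k‖ ^ 2 := by
    have hNpos : (0 : ℝ) < N := by positivity
    refine le_of_mul_le_mul_left ?_ hNpos
    rw [← P1, mul_left_comm, ← P2, mul_sum]
    refine sum_le_sum fun j _ => hterm _ ?_
    rw [norm_pow, hnorm, one_pow]
  have hTk : ∀ k, ‖(T ^ k) x‖ ≤ M * ‖x‖ := fun k =>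
    (ContinuousLinearMap.le_opNorm _ _).trans (by gcongr; exact hM k)
  have hwn : ∀ k, ‖w k‖ ≤ r⁻¹ ^ k * (M * ‖x‖) := by
    intro k
    simp only [hw, norm_smul, norm_pow, hnq]
    gcongr
    exact hTk k
  refine le_trans ?_ (hmain.trans ?_)
  · refine le_trans (le_of_eq ?_) (sum_le_sum_of_subset_of_nonneg
      (range_mono (by omega : m + 1 ≤ m + 1 + L)) (fun _ _ _ => by positivity))
    refine sum_congr rfl fun k hk => ?_
    have hk' : k ≤ m := by simp at hk; omega
    have hAT : A ((T ^ k) x) = (T ^ k * A) x := by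
      rw [← (hcomm.pow_right k).eq]; rfl
    simp only [hc, hw, map_smul, norm_smul, norm_pow, hnq, min_eq_left hk', Complex.norm_natCast, hAT]
    push_cast
    rfl
  · refine mul_le_mul_of_nonneg_left ?_ (sq_nonneg _)
    rw [sum_insert hnot, add_comm]
    refine add_le_add ?_ ?_
    · refine (sum_le_sum (g := fun _ => (M * ‖x‖) ^ 2) fun k hk => ?_).trans (by simp)
      have hk' : k ≤ m := by simp at hk; omega
      simp only [hb, hk', if_true]
      refine pow_le_pow_left₀ (norm_nonneg _) ((hwn k).trans ?_) 2
      exact mul_le_of_le_one_left (by positivity) (pow_le_one₀ (by positivity) hri)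
    · have h5 : ¬ (m + 1 + L ≤ m) := by omega
      simp only [hb, h5, if_false, norm_neg, norm_smul, Complex.norm_natCast]
      push_cast
      refine pow_le_pow_left₀ (by positivity) ?_ 2
      gcongr
      exact hwn _

open Finset Filter Topology in
theorem aux_sum_lim {X : Type*} [NormedAddCommGroup X] [InnerProductSpace ℂ X] [CompleteSpace X]
    (T A : X →L[ℂ] X) (hcomm : Commute A T) (M : ℝ) (hM : ∀ m : ℕ, ‖T ^ m‖ ≤ M) (B : ℝ)
    (hB : ∀ lambda : ℂ, 1 < ‖lambda‖ → ‖A * resolvent T lambda‖ ≤ B) (x : X) (m : ℕ) :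
    ∑ k ∈ range (m + 1), ((k + 1 : ℝ) * ‖(T ^ k * A) x‖) ^ 2
      ≤ B ^ 2 * (((m + 1 : ℝ)) * (M * ‖x‖) ^ 2) := by
  have h1 : ∀ r : ℝ, 1 < r →
      ∑ k ∈ range (m + 1), ((k + 1 : ℝ) * ((r⁻¹) ^ k * ‖(T ^ k * A) x‖)) ^ 2
      ≤ (r * B) ^ 2 * (((m + 1 : ℝ)) * (M * ‖x‖) ^ 2) := by
    intro r hr
    have ht : Tendsto (fun L : ℕ => (r⁻¹) ^ (m + 1 + L)) atTop (𝓝 0) := by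
      have := (tendsto_pow_atTop_nhds_zero_of_lt_one (by positivity : 0 ≤ r⁻¹)
        (inv_lt_one_of_one_lt₀ hr))
      exact this.comp (tendsto_atTop_mono (fun L => Nat.le_add_left L (m + 1)) tendsto_id)
    have ht2 : Tendsto (fun L : ℕ => (r * B) ^ 2 * (((m + 1 : ℝ)) * (M * ‖x‖) ^ 2
        + ((m + 1 : ℝ) * ((r⁻¹) ^ (m + 1 + L) * (M * ‖x‖))) ^ 2)) atTop
        (𝓝 ((r * B) ^ 2 * (((m + 1 : ℝ)) * (M * ‖x‖) ^ 2
        + ((m + 1 : ℝ) * (0 * (M * ‖x‖))) ^ 2))) :=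
      ((((ht.mul_const _).const_mul _).pow 2).const_add _).const_mul _
    have := ge_of_tendsto' ht2 (fun L => aux_sum T A hcomm M hM B hB r hr x m L)
    simpa using this
  have hl : Tendsto (fun r : ℝ => ∑ k ∈ range (m + 1),
      ((k + 1 : ℝ) * ((r⁻¹) ^ k * ‖(T ^ k * A) x‖)) ^ 2) (𝓝[>] 1)
      (𝓝 (∑ k ∈ range (m + 1), ((k + 1 : ℝ) * (((1:ℝ)⁻¹) ^ k * ‖(T ^ k * A) x‖)) ^ 2)) := by
    have hi : Tendsto (fun r : ℝ => r⁻¹) (𝓝[>] 1) (𝓝 (1 : ℝ)⁻¹) :=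
      (tendsto_inv₀ one_ne_zero).mono_left nhdsWithin_le_nhds
    exact tendsto_finsetSum _ fun k _ => (((hi.pow k).mul_const _).const_mul _).pow 2
  have hrr : Tendsto (fun r : ℝ => (r * B) ^ 2 * (((m + 1 : ℝ)) * (M * ‖x‖) ^ 2)) (𝓝[>] 1)
      (𝓝 ((1 * B) ^ 2 * (((m + 1 : ℝ)) * (M * ‖x‖) ^ 2))) :=
    (((tendsto_id.mono_left nhdsWithin_le_nhds).mul_const _).pow 2).mul_const _
  have := le_of_tendsto_of_tendsto hl hrr
    (eventually_nhdsWithin_of_forall fun r hr => h1 r hr)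
  simpa using this

/-- If `T` is power-bounded with constant `M` on a complex Hilbert space and
`B = sup{‖(I−T)ⁿ R(λ,T)‖ : |λ| > 1} < ∞`, then `‖T^m(I−T)ⁿ‖ ≤ 2M²B/(m+2)` for all `m ≥ 0`. -/
theorem stmt_17 {X : Type*} [NormedAddCommGroup X] [InnerProductSpace ℂ X] [CompleteSpace X]
    (T : X →L[ℂ] X) (M : ℝ) (hM : ∀ m : ℕ, ‖T ^ m‖ ≤ M)
    (n : ℕ) (hn : 1 ≤ n) (B : ℝ)
    (hB : ∀ lambda : ℂ, 1 < ‖lambda‖ → ‖(1 - T) ^ n * resolvent T lambda‖ ≤ B) :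
    ∀ m : ℕ, ‖T ^ m * (1 - T) ^ n‖ ≤ 2 * M ^ 2 * B / (m + 2) := by
  intro m
  have hM0 : 0 ≤ M := (norm_nonneg _).trans (hM 0)
  have hB0 : 0 ≤ B := (norm_nonneg _).trans (hB 2 (by simp))
  have hcomm : Commute ((1 - T) ^ n) T :=
    ((Commute.one_left T).sub_left (Commute.refl T)).pow_left n
  generalize (1 - T) ^ n = A at *
  refine ContinuousLinearMap.opNorm_le_bound _ (by positivity) fun x => ?_
  have hsum := aux_sum_lim T A hcomm M hM B hB x m
  set S := ∑ k ∈ Finset.range (m + 1), (k + 1 : ℝ) * ‖(T ^ k * A) x‖ with hS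
  have hS0 : 0 ≤ S := Finset.sum_nonneg fun _ _ => by positivity
  have hCS : S ^ 2 ≤ (m + 1 : ℝ) *
      ∑ k ∈ Finset.range (m + 1), ((k + 1 : ℝ) * ‖(T ^ k * A) x‖) ^ 2 := by
    have := sq_sum_le_card_mul_sum_sq (s := Finset.range (m + 1))
      (f := fun k : ℕ => (k + 1 : ℝ) * ‖(T ^ k * A) x‖)
    rw [Finset.card_range] at this; rw [Nat.cast_succ] at this; exact this
  have hSle : S ≤ (m + 1 : ℝ) * (B * (M * ‖x‖)) := by
    refine le_of_sq_le_sq ?_ (by positivity)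
    calc S ^ 2 ≤ _ := hCS
      _ ≤ (m + 1 : ℝ) * (B ^ 2 * (((m + 1 : ℝ)) * (M * ‖x‖) ^ 2)) := by gcongr
      _ = _ := by ring
  have hg : ∀ p : ℕ, ∑ k ∈ Finset.range p, (k + 1 : ℝ) = p * (p + 1) / 2 := by
    intro p
    induction p with
    | zero => simp
    | succ p ih => rw [Finset.sum_range_succ, ih]; push_cast; ring
  have hlow : (m + 1 : ℝ) * (m + 2) / 2 * ‖(T ^ m * A) x‖ ≤ M * S := by
    have h := hg (m + 1)
    have h' : (m + 1 : ℝ) * (m + 2) / 2 = ∑ k ∈ Finset.range (m + 1), (k + 1 : ℝ) := by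
      rw [h]; push_cast; ring
    rw [h', Finset.sum_mul, hS, Finset.mul_sum]
    refine Finset.sum_le_sum fun k hk => ?_
    have hk' : k ≤ m := by simp at hk; omega
    have e : (T ^ m * A) x = (T ^ (m - k)) ((T ^ k * A) x) := by
      rw [← ContinuousLinearMap.mul_apply, ← mul_assoc, ← pow_add, Nat.sub_add_cancel hk']
    have : ‖(T ^ m * A) x‖ ≤ M * ‖(T ^ k * A) x‖ := by
      rw [e]
      exact (ContinuousLinearMap.le_opNorm _ _).trans (by gcongr; exact hM _)
    calc (k + 1 : ℝ) * ‖(T ^ m * A) x‖ ≤ (k + 1 : ℝ) * (M * ‖(T ^ k * A) x‖) := by gcongr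
      _ = _ := by ring
  have hfin : (m + 1 : ℝ) * ((m + 2) / 2 * ‖(T ^ m * A) x‖) ≤ (m + 1 : ℝ) * (M ^ 2 * B * ‖x‖) := by
    calc _ = (m + 1 : ℝ) * (m + 2) / 2 * ‖(T ^ m * A) x‖ := by ring
      _ ≤ M * S := hlow
      _ ≤ M * ((m + 1 : ℝ) * (B * (M * ‖x‖))) := by gcongr
      _ = _ := by ring
  have hfin2 := le_of_mul_le_mul_left hfin (by positivity)
  rw [div_mul_eq_mul_div, le_div_iff₀ (by positivity)]
  linarith
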